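/- arXiv:2605.16092 — 5 statements merged into one kernel-verified Lean document; each statement's English description precedes it below -/
import Mathlib

section
/- Let A⁺ be a Noetherian commutative ring, let p ∈ A⁺ be a nonzerodivisor, and let A be the localization of A⁺ away from p (so A = A⁺[1/p]). Assume that A⁺ is integrally closed in A, i.e. every element of A that is integral over A⁺ lies in the image of the canonical map A⁺ → A. If x ∈ A is power-bounded in the sense that there exists N ∈ ℕ such that p^N · x^m lies in the image of A⁺ → A for every m ∈ ℕ, then x lies in the image of A⁺ → A. -/
/-- **Power-bounded elements lie in an integrally closed ring of definition.**
Let `A⁺` be a Noetherian commutative ring, `p ∈ A⁺` a nonzerodivisor, and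
`A = A⁺[1/p]` the localization away from `p`.  If `A⁺` is integrally closed in `A`
(every element of `A` integral over `A⁺` lies in the image of `A⁺ → A`), then every
power-bounded element `x ∈ A` (i.e. `p^N * x^m` lies in the image of `A⁺ → A` for some
`N` and all `m`) lies in the image of `A⁺ → A`. -/
theorem powerBounded_mem_of_integrallyClosed
    (Aplus : Type*) [CommRing Aplus] [IsNoetherianRing Aplus]
    (p : Aplus) (hp : p ∈ nonZeroDivisors Aplus)
    (A : Type*) [CommRing A] [Algebra Aplus A] [IsLocalization.Away p A]
    (hclosed : ∀ a : A, IsIntegral Aplus a → a ∈ Set.range (algebraMap Aplus A))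
    (x : A)
    (hx : ∃ N : ℕ, ∀ m : ℕ, (algebraMap Aplus A p) ^ N * x ^ m ∈ Set.range (algebraMap Aplus A)) :
    x ∈ Set.range (algebraMap Aplus A) := by
  obtain ⟨N, hN⟩ := hx
  apply hclosed
  refine IsAlmostIntegral.isIntegral_of_nonZeroDivisors_le_comap (R := Aplus) (S := A) ⟨p ^ N, pow_mem hp N, fun m => ?_⟩ ?_
  · simpa [Algebra.smul_def] using hN m
  · intro r hr
    exact IsLocalization.map_nonZeroDivisors_le (Submonoid.powers p) A ⟨r, hr, rfl⟩
end

section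
/- Let A be a Henselian local ring and let B be a local ring equipped with an A-algebra structure such that B is a finite étale A-algebra (B is finitely generated as an A-module and the algebra A → B is étale), the structure map A → B is a local ring homomorphism, and the induced map on residue fields κ(A) → κ(B) is bijective. Then the structure map A → B is bijective. -/
universe u

/-- A finite étale local algebra over a Henselian local ring, whose structure map is a
local ring homomorphism inducing a bijection on residue fields, is trivial: the structure
map `A → B` is bijective. -/
theorem bijective_of_finite_etale_henselian
    (A B : Type u) [CommRing A] [HenselianLocalRing A]
    [CommRing B] [IsLocalRing B] [Algebra A B]
    [Module.Finite A B] [Algebra.Etale A B]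
    [IsLocalHom (algebraMap A B)]
    (hres : Function.Bijective (IsLocalRing.ResidueField.map (algebraMap A B))) :
    Function.Bijective (algebraMap A B) := by
  constructor
  · have : Module.FaithfullyFlat A B := Module.FaithfullyFlat.of_flat_of_isLocalHom
    exact FaithfulSMul.algebraMap_injective A B
  · change Function.Surjective (Algebra.linearMap A B)
    rw [← LinearMap.range_eq_top, ← top_le_iff]
    apply Submodule.le_of_le_smul_of_le_jacobson_bot Module.Finite.fg_top
      (IsLocalRing.maximalIdeal_le_jacobson _)
    rw [Ideal.smul_top_eq_map, Algebra.FormallyUnramified.map_maximalIdeal]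
    rintro x -
    obtain ⟨a, ha⟩ := hres.2 (IsLocalRing.residue B x)
    obtain ⟨a, rfl⟩ := IsLocalRing.residue_surjective a
    rw [IsLocalRing.ResidueField.map_residue, ← sub_eq_zero, ← map_sub,
      IsLocalRing.residue_eq_zero_iff] at ha
    rw [← sub_sub_self (algebraMap _ _ a) x]
    exact sub_mem (Submodule.mem_sup_left ⟨_, rfl⟩) (Submodule.mem_sup_right ha)
end

section
/- Let E be a field complete with respect to a nontrivial nonarchimedean absolute value ‖·‖ whose value group is discrete: there is a real number q > 1 such that ‖x‖ is an integer power of q for every nonzero x ∈ E. Let V be a d-dimensional E-vector space with d ≥ 1, and let (Nₙ)ₙ be a sequence of nonarchimedean norms on V which is Cauchy for the Goldman–Iwahori distance, i.e. for every ε > 0 there exists M such that for all n, m ≥ M and every nonzero v ∈ V one has |log Nₙ(v) − log Nₘ(v)| ≤ ε. Then there exists a nonarchimedean norm N on V such that (Nₙ)ₙ converges to N for the Goldman–Iwahori distance: for every ε > 0 there exists M such that for all n ≥ M and every nonzero v ∈ V one has |log Nₙ(v) − log N(v)| ≤ ε. -/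
/-- **Completeness of the space of norms.**  Let `E` be a complete nontrivially valued
nonarchimedean field with discrete value group (`‖x‖ ∈ q^ℤ` for `x ≠ 0`, `q > 1`), and
`V` a `d`-dimensional `E`-vector space with `d ≥ 1`.  Any sequence of nonarchimedean
norms on `V` which is Cauchy for the Goldman–Iwahori distance converges to a
nonarchimedean norm on `V` for that distance. -/
theorem norm_space_complete
    (E : Type*) [NontriviallyNormedField E] [CompleteSpace E] [IsUltrametricDist E]
    (q : ℝ) (hq : 1 < q)
    (hdisc : ∀ x : E, x ≠ 0 → ∃ n : ℤ, ‖x‖ = q ^ n)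
    (V : Type*) [AddCommGroup V] [Module E V]
    (d : ℕ) (hd : 1 ≤ d) (hdim : Module.finrank E V = d)
    (N : ℕ → V → ℝ)
    (hnorm : ∀ n : ℕ,
      (∀ v : V, N n v = 0 ↔ v = 0) ∧
      (∀ (c : E) (v : V), N n (c • v) = ‖c‖ * N n v) ∧
      (∀ v w : V, N n (v + w) ≤ max (N n v) (N n w)))
    (hcauchy : ∀ ε : ℝ, 0 < ε → ∃ M : ℕ, ∀ m l : ℕ, M ≤ m → M ≤ l →
      ∀ v : V, v ≠ 0 → |Real.log (N m v) - Real.log (N l v)| ≤ ε) :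
    ∃ Nlim : V → ℝ,
      ((∀ v : V, Nlim v = 0 ↔ v = 0) ∧
       (∀ (c : E) (v : V), Nlim (c • v) = ‖c‖ * Nlim v) ∧
       (∀ v w : V, Nlim (v + w) ≤ max (Nlim v) (Nlim w))) ∧
      (∀ ε : ℝ, 0 < ε → ∃ M : ℕ, ∀ m : ℕ, M ≤ m →
        ∀ v : V, v ≠ 0 → |Real.log (N m v) - Real.log (Nlim v)| ≤ ε) := by
  have hpos : ∀ n v, v ≠ 0 → 0 < N n v := by
    intro n v hv
    obtain ⟨h0, hs, hu⟩ := hnorm n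
    have h1 := hu v ((-1 : E) • v)
    rw [hs] at h1
    have h2 : v + (-1 : E) • v = 0 := by simp
    rw [h2, (h0 0).2 rfl] at h1
    simp only [norm_neg, norm_one, one_mul, max_self] at h1
    exact lt_of_le_of_ne h1 (fun h => hv ((h0 v).1 h.symm))
  have hL : ∀ v : V, ∃ L : ℝ, v ≠ 0 →
      Filter.Tendsto (fun n => Real.log (N n v)) Filter.atTop (nhds L) := by
    intro v
    by_cases hv : v = 0
    · exact ⟨0, fun h => absurd hv h⟩
    have hc : CauchySeq (fun n => Real.log (N n v)) := by
      rw [Metric.cauchySeq_iff]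
      intro ε hε
      obtain ⟨M, hM⟩ := hcauchy (ε / 2) (by linarith)
      refine ⟨M, fun m hm n hn => ?_⟩
      rw [Real.dist_eq]
      have := hM m n hm hn v hv
      linarith
    obtain ⟨L, hl⟩ := cauchySeq_tendsto_of_complete hc
    exact ⟨L, fun _ => hl⟩
  choose L hL using hL
  classical
  let F : V → ℝ := fun v => if v = 0 then 0 else Real.exp (L v)
  have hF0 : F 0 = 0 := by simp [F]
  have hF1 : ∀ v, v ≠ 0 → F v = Real.exp (L v) := fun v hv => by simp [F, hv]
  have hT : ∀ v, Filter.Tendsto (fun n => N n v) Filter.atTop (nhds (F v)) := by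
    intro v
    by_cases hv : v = 0
    · subst hv
      have : (fun n => N n (0 : V)) = fun _ => 0 := funext fun n => ((hnorm n).1 0).2 rfl
      rw [this, hF0]
      exact tendsto_const_nhds
    · rw [hF1 v hv]
      have h := (Real.continuous_exp.tendsto (L v)).comp (hL v hv)
      refine h.congr (fun n => ?_)
      exact Real.exp_log (hpos n v hv)
  refine ⟨F, ⟨?_, ?_, ?_⟩, ?_⟩
  · intro v
    refine ⟨fun h => ?_, fun h => by rw [h, hF0]⟩
    by_contra hv
    rw [hF1 v hv] at h
    exact (Real.exp_pos _).ne' h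
  · intro c v
    refine tendsto_nhds_unique (hT (c • v)) ?_
    refine ((hT v).const_mul ‖c‖).congr (fun n => ?_)
    exact ((hnorm n).2.1 c v).symm
  · intro v w
    exact le_of_tendsto_of_tendsto' (hT (v + w)) ((hT v).max (hT w))
      (fun n => (hnorm n).2.2 v w)
  · intro ε hε
    obtain ⟨M, hM⟩ := hcauchy ε hε
    refine ⟨M, fun m hm v hv => ?_⟩
    rw [hF1 v hv, Real.log_exp]
    refine le_of_tendsto ((hL v hv).const_sub (Real.log (N m v))).abs ?_
    filter_upwards [Filter.eventually_ge_atTop M] with l hl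
    exact hM m l hm hl v hv
end

section
/- Let d ≥ 1 be an integer and let λ₀ ≤ λ₁ ≤ ⋯ ≤ λ_{d−1} be rational numbers satisfying: 0 ≤ λᵢ ≤ 1 for all i; the total sum λ₀ + ⋯ + λ_{d−1} = 1; and for every index j with 0 ≤ j < d−1 such that λⱼ ≠ λ_{j+1}, the partial sum λ₀ + ⋯ + λⱼ is an integer. Then there exists an integer r with 0 ≤ r ≤ d−1 such that λᵢ = 0 for all i < r and λᵢ = 1/(d−r) for all i with r ≤ i ≤ d−1. -/
/-- **Newton slopes of a one-dimensional `ϖ`-divisible `O`-module.**  Let `d ≥ 1` and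
`λ₀ ≤ ⋯ ≤ λ_{d−1}` be rationals in `[0,1]` with total sum `1`, such that whenever
`λⱼ ≠ λ_{j+1}` the partial sum `λ₀ + ⋯ + λⱼ` is an integer.  Then there is an `r` with
`0 ≤ r ≤ d − 1` such that `λᵢ = 0` for `i < r` and `λᵢ = 1/(d − r)` for `i ≥ r`. -/
theorem newton_slopes_height_d_dim_one
    (d : ℕ) (hd : 1 ≤ d) (lam : Fin d → ℚ)
    (hmono : Monotone lam)
    (hrange : ∀ i, 0 ≤ lam i ∧ lam i ≤ 1)
    (hsum : ∑ i, lam i = 1)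
    (hbreak : ∀ (j : ℕ) (hj : j + 1 < d),
      lam ⟨j, Nat.lt_of_succ_lt hj⟩ ≠ lam ⟨j + 1, hj⟩ →
      ∃ z : ℤ, (∑ i ∈ Finset.Iic (⟨j, Nat.lt_of_succ_lt hj⟩ : Fin d), lam i) = (z : ℚ)) :
    ∃ r : ℕ, r ≤ d - 1 ∧
      (∀ i : Fin d, (i : ℕ) < r → lam i = 0) ∧
      (∀ i : Fin d, r ≤ (i : ℕ) → lam i = 1 / ((d - r : ℕ) : ℚ)) := by
  have key : ∀ (j : ℕ) (hj : j + 1 < d),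
      lam ⟨j, Nat.lt_of_succ_lt hj⟩ ≠ lam ⟨j + 1, hj⟩ →
      lam ⟨j, Nat.lt_of_succ_lt hj⟩ = 0 := by
    intro j hj hne
    obtain ⟨z, hz⟩ := hbreak j hj hne
    have hle : lam ⟨j, Nat.lt_of_succ_lt hj⟩ ≤ lam ⟨j + 1, hj⟩ :=
      hmono (by simp [Fin.le_def])
    have hlt := lt_of_le_of_ne hle hne
    have h0 := (hrange ⟨j, Nat.lt_of_succ_lt hj⟩).1
    have h1 : lam ⟨j, Nat.lt_of_succ_lt hj⟩ ≤
        ∑ i ∈ Finset.Iic (⟨j, Nat.lt_of_succ_lt hj⟩ : Fin d), lam i :=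
      Finset.single_le_sum (f := lam) (fun i _ => (hrange i).1) (by simp)
    have hnot : (⟨j + 1, hj⟩ : Fin d) ∉ Finset.Iic (⟨j, Nat.lt_of_succ_lt hj⟩ : Fin d) := by
      simp [Fin.le_def]
    have h2 : ∑ i ∈ insert (⟨j + 1, hj⟩ : Fin d)
        (Finset.Iic (⟨j, Nat.lt_of_succ_lt hj⟩ : Fin d)), lam i ≤ ∑ i, lam i :=
      Finset.sum_le_sum_of_subset_of_nonneg (Finset.subset_univ _)
        (fun i _ _ => (hrange i).1)
    rw [Finset.sum_insert hnot, hsum, hz] at h2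
    rw [hz] at h1
    have hz1 : (z : ℚ) < 1 := by linarith
    have hz2 : z < 1 := by exact_mod_cast hz1
    have hz3 : (z : ℚ) ≤ 0 := by exact_mod_cast (by omega : z ≤ 0)
    linarith
  have hex : ∃ n : ℕ, ∃ h : n < d, lam ⟨n, h⟩ ≠ 0 := by
    by_contra! hcon
    have : ∑ i, lam i = 0 := Finset.sum_eq_zero (fun i _ => hcon i i.2)
    rw [hsum] at this
    exact one_ne_zero this
  classical
  obtain ⟨r, ⟨hr, hrne⟩, hmin⟩ : ∃ r : ℕ, (∃ h : r < d, lam ⟨r, h⟩ ≠ 0) ∧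
      ∀ m < r, ¬ ∃ h : m < d, lam ⟨m, h⟩ ≠ 0 :=
    ⟨Nat.find hex, Nat.find_spec hex, fun m hm => Nat.find_min hex hm⟩
  have hz : ∀ i : Fin d, (i : ℕ) < r → lam i = 0 := by
    intro i hi
    by_contra hne
    exact hmin i hi ⟨i.2, hne⟩
  have hc : ∀ n : ℕ, r ≤ n → ∀ h : n < d, lam ⟨n, h⟩ = lam ⟨r, hr⟩ := by
    intro n hn
    induction n, hn using Nat.le_induction with
    | base => intro h; rfl
    | succ n hn ih =>
      intro h
      have h1 := ih (Nat.lt_of_succ_lt h)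
      by_contra hne
      have h2 := key n h (by rw [h1]; exact fun h => hne h.symm)
      exact hrne (h1 ▸ h2)
  have hs : ((d - r : ℕ) : ℚ) * lam ⟨r, hr⟩ = 1 := by
    have h1 : ∑ i ∈ Finset.Ici (⟨r, hr⟩ : Fin d), lam i = ∑ i, lam i := by
      apply Finset.sum_subset (Finset.subset_univ _)
      intro i _ hi
      apply hz
      simpa [Fin.lt_def] using hi
    have h2 : ∑ i ∈ Finset.Ici (⟨r, hr⟩ : Fin d), lam i =
        ∑ i ∈ Finset.Ici (⟨r, hr⟩ : Fin d), lam ⟨r, hr⟩ := by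
      apply Finset.sum_congr rfl
      intro i hi
      exact hc i (by simpa [Fin.le_def] using hi) i.2
    rw [h2, hsum, Finset.sum_const, Fin.card_Ici, nsmul_eq_mul] at h1
    exact h1
  refine ⟨r, by omega, hz, fun i hi => ?_⟩
  have h1 : lam i = lam ⟨r, hr⟩ := hc i hi i.2
  rw [h1]
  exact eq_one_div_of_mul_eq_one_right hs
end

section
/- Let k be a field of characteristic p > 0 and let q = p^f for some integer f ≥ 1. Let V be a k-vector space and let φ : V → V be an additive map that is q-Frobenius-semilinear, i.e. φ(a • v) = a^q • φ(v) for all a ∈ k and v ∈ V. Let d ≥ 2 and let v₀, v₁, …, v_{d−1} ∈ V be vectors that are linearly independent over k and satisfy φ(vₗ) = v_{l+1} for all 0 ≤ l ≤ d−2. If v belongs to the k-linear span of v₀, …, v_{d−2} and satisfies φ(v) = v, then v = 0. -/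
/-- Let `k` be a field of characteristic `p > 0` and `q = p^f` with `f ≥ 1`.  Let
`φ : V → V` be an additive `q`-Frobenius-semilinear map on a `k`-vector space `V`, and
let `v₀, …, v_{d−1}` (`d ≥ 2`) be linearly independent vectors with `φ(vₗ) = v_{l+1}`
for `0 ≤ l ≤ d − 2`.  If `w` lies in the span of `v₀, …, v_{d−2}` and `φ(w) = w`, then
`w = 0`. -/
theorem frobenius_fixed_in_hyperplane_eq_zero
    (k : Type*) [Field k] (p : ℕ) [Fact p.Prime] [CharP k p]
    (f : ℕ) (hf : 1 ≤ f) (q : ℕ) (hq : q = p ^ f)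
    (V : Type*) [AddCommGroup V] [Module k V]
    (φ : V → V)
    (hadd : ∀ x y : V, φ (x + y) = φ x + φ y)
    (hsemi : ∀ (a : k) (v : V), φ (a • v) = a ^ q • φ v)
    (d : ℕ) (hd : 2 ≤ d) (v : Fin d → V)
    (hli : LinearIndependent k v)
    (hshift : ∀ (l : ℕ) (hl : l + 1 < d),
      φ (v ⟨l, Nat.lt_of_succ_lt hl⟩) = v ⟨l + 1, hl⟩)
    (w : V)
    (hw : w ∈ Submodule.span k
      (Set.range fun i : Fin (d - 1) => v (Fin.castLE (Nat.sub_le d 1) i)))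
    (hfix : φ w = w) :
    w = 0 := by
  obtain ⟨n, rfl⟩ : ∃ n, d = n + 1 := ⟨d - 1, by omega⟩
  have hq0 : q ≠ 0 := by
    rw [hq]
    exact pow_ne_zero _ (Fact.out : p.Prime).ne_zero
  obtain ⟨c, hc⟩ := (Submodule.mem_span_range_iff_exists_fun k).1 hw
  change Fin n → k at c
  change ∑ i : Fin n, c i • v i.castSucc = w at hc
  let F : V →+ V := AddMonoidHom.mk' φ hadd
  have h1 : w = ∑ i : Fin n, c i ^ q • v i.succ := by
    have h2 : F w = w := hfix
    rw [← h2, ← hc, map_sum]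
    refine Finset.sum_congr rfl fun i _ => ?_
    change φ _ = _
    rw [hsemi]
    congr 1
    exact hshift i.1 (by omega)
  let a : Fin (n + 1) → k := Fin.snoc (α := fun _ => k) c 0
  let b : Fin (n + 1) → k := Fin.cons (α := fun _ => k) 0 (fun i => c i ^ q)
  have ha : ∑ i, a i • v i = w := by
    rw [Fin.sum_univ_castSucc]
    simp [a, hc]
  have hb : ∑ i, b i • v i = w := by
    rw [Fin.sum_univ_succ]
    simp [b, ← h1]
  have hab : ∀ i, a i = b i := by
    intro i
    have h3 := Fintype.linearIndependent_iff.1 hli (fun i => a i - b i)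
      (by simp only [sub_smul, Finset.sum_sub_distrib, ha, hb, sub_self]) i
    exact sub_eq_zero.1 h3
  have h0 : ∀ i, a i = 0 := by
    intro i
    induction i using Fin.induction with
    | zero => rw [hab]; simp [b]
    | succ i ih =>
      rw [hab]
      have : c i = 0 := by simpa [a] using ih
      simp [b, this, hq0]
  rw [← ha]
  simp [h0]
end
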